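/- Fix d ≥ 2 and let Z be a standard Gaussian vector in ℝ^d. For every constant k with 0 < k < (d/(d−1))·√(π/(π−3))·(2/B(1/2,(d−1)/2)), we have E[d·‖Z‖₂²/‖Z‖₁²] ≤ d/k² + (1 − 1/k²) / ( −k·√((π−3)/(π·d)) + 2·√d/((d−1)·B(1/2,(d−1)/2)) )², where B denotes the Beta function. (d·‖Z‖₂²/‖Z‖₁² has the same distribution as d/‖T‖₁² for T uniform on S^{d−1}.) -/

import Mathlib

open MeasureTheory BigOperators Real

/-- The law of a standard Gaussian vector in `ℝ^d`: the product of `d` standard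
normal distributions. -/
noncomputable def stdGaussian (d : ℕ) : Measure (Fin d → ℝ) :=
  Measure.pi fun _ => ProbabilityTheory.gaussianReal 0 1

/-- The Beta function `B(a,b) = Γ(a)Γ(b)/Γ(a+b)`. -/
noncomputable def realBeta (a b : ℝ) : ℝ :=
  Real.Gamma a * Real.Gamma b / Real.Gamma (a + b)

/-- Integral of a homogeneous function against a radial weight in polar coordinates. -/
lemma integral_homogeneous_mul_fun_norm {E : Type*} [NormedAddCommGroup E] [NormedSpace ℝ E]
    [FiniteDimensional ℝ E] [Nontrivial E] [MeasurableSpace E] [BorelSpace E] (μ : Measure E)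
    [μ.IsAddHaarMeasure] (φ : E → ℝ) (p : ℕ)
    (hφ : ∀ r : ℝ, 0 < r → ∀ x, φ (r • x) = r ^ p * φ x) (g : ℝ → ℝ) :
    ∫ x, φ x * g ‖x‖ ∂μ = (∫ u : Metric.sphere (0 : E) 1, φ u ∂μ.toSphere) *
      ∫ r in Set.Ioi (0 : ℝ), r ^ (Module.finrank ℝ E - 1) * (r ^ p * g r) := by
  calc
    ∫ x, φ x * g ‖x‖ ∂μ
        = ∫ x : ({(0)}ᶜ : Set E), φ x.1 * g ‖x.1‖ ∂(μ.comap (↑)) := by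
      rw [integral_subtype_comap (measurableSet_singleton _).compl fun x ↦ φ x * g ‖x‖,
        restrict_compl_singleton]
    _ = ∫ x, φ x.1 * ((x.2 : ℝ) ^ p * g x.2)
          ∂μ.toSphere.prod (.volumeIoiPow (Module.finrank ℝ E - 1)) := by
      rw [← μ.measurePreserving_homeomorphUnitSphereProd.integral_comp
        (Homeomorph.measurableEmbedding _)]
      refine integral_congr_ae (.of_forall fun x ↦ ?_)
      have hx : 0 < ‖(x : E)‖ := norm_pos_iff.2 x.2
      have h := hφ _ hx (‖(x : E)‖⁻¹ • (x : E))
      rw [smul_inv_smul₀ hx.ne'] at h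
      simp only [homeomorphUnitSphereProd_apply_fst_coe, homeomorphUnitSphereProd_apply_snd_coe]
      rw [h]
      ring
    _ = (∫ u : Metric.sphere (0 : E) 1, φ u ∂μ.toSphere) *
          ∫ r : Set.Ioi (0 : ℝ), (r : ℝ) ^ p * g r
            ∂.volumeIoiPow (Module.finrank ℝ E - 1) :=
      integral_prod_mul (fun u : Metric.sphere (0 : E) 1 ↦ φ u)
        (fun r : Set.Ioi (0 : ℝ) ↦ (r : ℝ) ^ p * g r)
    _ = _ := by
      congr 1
      simp only [Measure.volumeIoiPow, ENNReal.ofReal]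
      rw [integral_withDensity_eq_integral_smul,
        integral_subtype_comap measurableSet_Ioi
          fun a ↦ Real.toNNReal (a ^ (Module.finrank ℝ E - 1)) • (a ^ p * g a),
        setIntegral_congr_fun measurableSet_Ioi fun x hx ↦ ?_]
      · rw [NNReal.smul_def, Real.coe_toNNReal _ (pow_nonneg hx.out.le _), smul_eq_mul]
      · exact (measurable_subtype_coe.pow_const _).real_toNNReal

lemma stdGaussian_eq_withDensity (d : ℕ) :
    stdGaussian d = volume.withDensity fun z : Fin d → ℝ ↦
      ENNReal.ofReal (∏ i, ProbabilityTheory.gaussianPDFReal 0 1 (z i)) := by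
  refine Measure.pi_eq fun s hs ↦ ?_
  rw [withDensity_apply _ (MeasurableSet.univ_pi hs), volume_pi, Measure.restrict_pi_pi,
    ← ofReal_integral_eq_lintegral_ofReal, integral_fintype_prod_eq_prod,
    ENNReal.ofReal_prod_of_nonneg]
  · simp_rw [ProbabilityTheory.gaussianReal_apply_eq_integral 0 one_ne_zero]
  · exact fun i _ ↦ integral_nonneg fun x ↦ ProbabilityTheory.gaussianPDFReal_nonneg _ _ _
  · exact Integrable.fintype_prod fun i ↦
      (ProbabilityTheory.integrable_gaussianPDFReal 0 1).restrict
  · exact .of_forall fun z ↦ Finset.prod_nonneg fun i _ ↦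
      ProbabilityTheory.gaussianPDFReal_nonneg _ _ _

lemma integral_stdGaussian_eq (d : ℕ) (f : (Fin d → ℝ) → ℝ) :
    ∫ z, f z ∂stdGaussian d =
      ∫ z, f z * ((√(2 * π))⁻¹ ^ d * exp (-(1 / 2) * √(∑ i, z i ^ 2) ^ 2)) := by
  rw [stdGaussian_eq_withDensity, integral_withDensity_eq_integral_toReal_smul]
  · refine integral_congr_ae (.of_forall fun z ↦ ?_)
    have h : ∏ i, ProbabilityTheory.gaussianPDFReal 0 1 (z i) =
        (√(2 * π))⁻¹ ^ d * exp (-(1 / 2) * √(∑ i, z i ^ 2) ^ 2) := by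
      rw [sq_sqrt (Finset.sum_nonneg fun i _ ↦ sq_nonneg _)]
      simp only [ProbabilityTheory.gaussianPDFReal, Finset.prod_mul_distrib, Finset.prod_const,
        ← exp_sum, Finset.card_univ, Fintype.card_fin, Finset.mul_sum, NNReal.coe_one, mul_one,
        sub_zero]
      congr 3 with i
      ring
    simp only [smul_eq_mul]
    rw [ENNReal.toReal_ofReal (Finset.prod_nonneg fun i _ ↦
      ProbabilityTheory.gaussianPDFReal_nonneg _ _ _), h, mul_comm]
  · have := ProbabilityTheory.measurable_gaussianPDFReal 0 1
    fun_prop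
  · exact .of_forall fun z ↦ ENNReal.ofReal_lt_top

lemma integral_pow_mul_exp_neg_half_sq (q : ℕ) :
    ∫ r in Set.Ioi (0 : ℝ), r ^ q * exp (-(1 / 2) * r ^ 2) =
      (1 / 2) ^ (-((q : ℝ) + 1) / 2) * (1 / 2) * Gamma (((q : ℝ) + 1) / 2) := by
  have h := integral_rpow_mul_exp_neg_mul_rpow (p := 2) (q := q) (b := 1 / 2) two_pos
    (by linarith [q.cast_nonneg (α := ℝ)]) (by norm_num)
  rw [← h]
  simp only [rpow_natCast, rpow_two]

/-- Independence of norm and direction of a standard Gaussian vector, in integrated form. -/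
lemma integral_stdGaussian_div_norm_pow (d : ℕ) (hd : 1 ≤ d) (φ : (Fin d → ℝ) → ℝ) (p : ℕ)
    (hφ : ∀ r : ℝ, 0 < r → ∀ z, φ (r • z) = r ^ p * φ z) :
    ∫ z, φ z / √(∑ i, z i ^ 2) ^ p ∂stdGaussian d =
      (∫ z, φ z ∂stdGaussian d) *
        ((1 / 2) ^ ((p : ℝ) / 2) * Gamma (d / 2) / Gamma ((d + p) / 2)) := by
  have : Nonempty (Fin d) := ⟨⟨0, hd⟩⟩
  have polar (g : ℝ → ℝ) : ∫ z : Fin d → ℝ, φ z * g √(∑ i, z i ^ 2) =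
      (∫ u : Metric.sphere (0 : EuclideanSpace ℝ (Fin d)) 1, φ (WithLp.ofLp u.1)
        ∂(volume : Measure (EuclideanSpace ℝ (Fin d))).toSphere) *
      ∫ r in Set.Ioi (0 : ℝ), r ^ (d - 1) * (r ^ p * g r) := by
    have h := integral_homogeneous_mul_fun_norm
      (volume : Measure (EuclideanSpace ℝ (Fin d))) (fun x ↦ φ (WithLp.ofLp x)) p
      (fun r hr x ↦ hφ r hr _) g
    rw [finrank_euclideanSpace_fin] at h
    rw [← h, ← (PiLp.volume_preserving_toLp (Fin d)).integral_comp
      (MeasurableEquiv.toLp 2 (Fin d → ℝ)).measurableEmbedding]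
    simp [EuclideanSpace.norm_eq]
  set c := (√(2 * π))⁻¹ ^ d
  have hleft := polar fun r ↦ (r ^ p)⁻¹ * (c * exp (-(1 / 2) * r ^ 2))
  have hright := polar fun r ↦ c * exp (-(1 / 2) * r ^ 2)
  have hdr : ((d - 1 : ℕ) : ℝ) + 1 = d := by
    rw [Nat.cast_sub hd]; simp
  have radial_left : ∫ r in Set.Ioi (0 : ℝ),
      r ^ (d - 1) * (r ^ p * ((r ^ p)⁻¹ * (c * exp (-(1 / 2) * r ^ 2)))) =
      c * ((1 / 2) ^ (-(d : ℝ) / 2) * (1 / 2) * Gamma (d / 2)) := by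
    rw [← hdr, ← integral_pow_mul_exp_neg_half_sq, ← integral_const_mul]
    refine setIntegral_congr_fun measurableSet_Ioi fun r hr ↦ ?_
    have : r ^ p ≠ 0 := pow_ne_zero _ (ne_of_gt hr)
    field_simp
  have radial_right : ∫ r in Set.Ioi (0 : ℝ),
      r ^ (d - 1) * (r ^ p * (c * exp (-(1 / 2) * r ^ 2))) =
      c * ((1 / 2) ^ (-((d : ℝ) + p) / 2) * (1 / 2) * Gamma ((d + p) / 2)) := by
    have h : ((d - 1 + p : ℕ) : ℝ) + 1 = d + p := by push_cast; linarith
    rw [← h, ← integral_pow_mul_exp_neg_half_sq, ← integral_const_mul]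
    refine setIntegral_congr_fun measurableSet_Ioi fun r hr ↦ ?_
    ring
  rw [radial_left] at hleft
  rw [radial_right] at hright
  rw [integral_stdGaussian_eq, integral_stdGaussian_eq, hright]
  simp only [div_eq_mul_inv (φ _), mul_assoc]
  simp only [mul_assoc] at hleft
  rw [hleft]
  have hΓ : Gamma (((d : ℝ) + p) / 2) ≠ 0 :=
    (Gamma_pos_of_pos (by positivity)).ne'
  have hpow : (1 / 2 : ℝ) ^ (-(d : ℝ) / 2) =
      (1 / 2) ^ (-((d : ℝ) + p) / 2) * (1 / 2) ^ ((p : ℝ) / 2) := by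
    rw [← rpow_add (by norm_num)]
    ring_nf
  rw [hpow]
  field_simp

lemma integral_abs_gaussianReal :
    ∫ x, |x| ∂ProbabilityTheory.gaussianReal 0 1 = √(2 / π) := by
  rw [ProbabilityTheory.integral_gaussianReal_eq_integral_smul one_ne_zero]
  have h : ∀ x : ℝ, ProbabilityTheory.gaussianPDFReal 0 1 x • |x| =
      (√(2 * π))⁻¹ * (|x| ^ 1 * exp (-(1 / 2) * |x| ^ 2)) := fun x ↦ by
    simp [ProbabilityTheory.gaussianPDFReal]
    ring_nf
  simp_rw [h]
  rw [integral_const_mul, integral_comp_abs (f := fun x ↦ x ^ 1 * exp (-(1 / 2) * x ^ 2)),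
    integral_pow_mul_exp_neg_half_sq]
  norm_num [Gamma_one, rpow_neg_one]
  have h2 : √(2 : ℝ) ^ 2 = 2 := sq_sqrt two_pos.le
  have : 0 < √π := sqrt_pos.2 pi_pos
  field_simp
  rw [h2]

instance isProbabilityMeasure_stdGaussian (d : ℕ) : IsProbabilityMeasure (stdGaussian d) := by
  unfold stdGaussian; infer_instance

lemma memLp_abs_eval_stdGaussian {d : ℕ} (i : Fin d) :
    MemLp (fun z : Fin d → ℝ ↦ |z i|) 2 (stdGaussian d) :=
  ((ProbabilityTheory.memLp_id_gaussianReal 2).comp_measurePreserving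
    (measurePreserving_eval (fun _ : Fin d ↦ ProbabilityTheory.gaussianReal 0 1) i)).abs

lemma integral_abs_eval_stdGaussian {d : ℕ} (i : Fin d) :
    ∫ z, |z i| ∂stdGaussian d = √(2 / π) := by
  rw [← integral_abs_gaussianReal]
  exact integral_comp_eval (μ := fun _ : Fin d ↦ ProbabilityTheory.gaussianReal 0 1)
    (f := fun x : ℝ ↦ |x|) (by fun_prop)

lemma integral_abs_mul_abs_eval_stdGaussian {d : ℕ} (i j : Fin d) :
    ∫ z, |z i| * |z j| ∂stdGaussian d = if i = j then 1 else 2 / π := by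
  split_ifs with h
  · subst h
    simp_rw [abs_mul_abs_self, ← sq]
    have h1 : ∫ z : Fin d → ℝ, z i ^ 2 ∂stdGaussian d =
        ∫ x, x ^ 2 ∂ProbabilityTheory.gaussianReal 0 1 :=
      integral_comp_eval (μ := fun _ : Fin d ↦ ProbabilityTheory.gaussianReal 0 1)
        (f := fun x : ℝ ↦ x ^ 2) (by fun_prop)
    have h2 := ProbabilityTheory.variance_id_gaussianReal (μ := 0) (v := 1)
    rw [ProbabilityTheory.variance_of_integral_eq_zero aemeasurable_id (by simp)] at h2
    simpa [h1] using h2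
  · have hind : ProbabilityTheory.iIndepFun (fun i (z : Fin d → ℝ) ↦ |z i|) (stdGaussian d) :=
      ProbabilityTheory.iIndepFun_pi (X := fun _ (x : ℝ) ↦ |x|) (fun _ ↦ by fun_prop)
    rw [(hind.indepFun h).integral_fun_mul_eq_mul_integral
      (memLp_abs_eval_stdGaussian i).aestronglyMeasurable
      (memLp_abs_eval_stdGaussian j).aestronglyMeasurable,
      integral_abs_eval_stdGaussian, integral_abs_eval_stdGaussian,
      mul_self_sqrt (by positivity)]

lemma integral_sum_abs_stdGaussian (d : ℕ) :
    ∫ z, ∑ i, |z i| ∂stdGaussian d = d * √(2 / π) := by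
  rw [integral_finsetSum _ fun i _ ↦ (memLp_abs_eval_stdGaussian i).integrable one_le_two]
  simp [integral_abs_eval_stdGaussian]

lemma integral_sum_abs_sq_stdGaussian (d : ℕ) :
    ∫ z, (∑ i, |z i|) ^ 2 ∂stdGaussian d = d + d * (d - 1) * (2 / π) := by
  have hint (i j : Fin d) : Integrable (fun z : Fin d → ℝ ↦ |z i| * |z j|) (stdGaussian d) :=
    (memLp_abs_eval_stdGaussian i).integrable_mul (memLp_abs_eval_stdGaussian j)
  simp_rw [sq, Finset.sum_mul_sum]
  rw [integral_finsetSum _ fun i _ ↦ integrable_finsetSum _ fun j _ ↦ hint i j]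
  simp_rw [integral_finsetSum _ fun j _ ↦ hint _ j, integral_abs_mul_abs_eval_stdGaussian]
  have h (i j : Fin d) : (if i = j then 1 else 2 / π) = 2 / π + if i = j then 1 - 2 / π else 0 := by
    split_ifs <;> ring
  simp_rw [h, Finset.sum_add_distrib]
  simp
  ring

/-- The Watson lower bound for the Wallis ratio. -/
lemma add_quarter_mul_Gamma_sq_le {x : ℝ} (hx : 0 < x) :
    (x + 1 / 4) * Gamma (x + 1 / 2) ^ 2 ≤ Gamma (x + 1) ^ 2 := by
  set f : ℝ → ℝ := fun y ↦ Gamma (y + 1) ^ 2 / ((y + 1 / 4) * Gamma (y + 1 / 2) ^ 2)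
  have step {y : ℝ} (hy : 0 < y) : f (y + 1) ≤ f y := by
    have h1 : Gamma (y + 1 + 1) = (y + 1) * Gamma (y + 1) := Gamma_add_one (by positivity)
    have h2 : Gamma (y + 1 + 1 / 2) = (y + 1 / 2) * Gamma (y + 1 / 2) := by
      rw [← Gamma_add_one (by positivity)]; ring_nf
    have g1 := Gamma_pos_of_pos (show 0 < y + 1 by positivity)
    have g2 := Gamma_pos_of_pos (show 0 < y + 1 / 2 by positivity)
    simp only [f]
    rw [h1, h2, div_le_div_iff₀ (by positivity) (by positivity)]
    have : 0 ≤ Gamma (y + 1) ^ 2 * Gamma (y + 1 / 2) ^ 2 := by positivity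
    nlinarith
  have lower {y : ℝ} (hy : 0 < y) : y / (y + 1 / 4) ≤ f y := by
    have g1 := Gamma_pos_of_pos (show 0 < y + 1 by positivity)
    have g2 := Gamma_pos_of_pos (show 0 < y + 1 / 2 by positivity)
    have h := Gamma_mul_add_mul_le_rpow_Gamma_mul_rpow_Gamma hy
      (show 0 < y + 1 by positivity) (a := 1 / 2) (b := 1 / 2) (by norm_num) (by norm_num)
      (by norm_num)
    rw [show 1 / 2 * y + 1 / 2 * (y + 1) = y + 1 / 2 by ring, ← sqrt_eq_rpow, ← sqrt_eq_rpow,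
      ← sqrt_mul (Gamma_pos_of_pos hy).le] at h
    have h2 := (le_sqrt' g2).1 h
    have h3 := Gamma_add_one hy.ne'
    simp only [f]
    rw [div_le_div_iff₀ (by positivity) (by positivity)]
    have h4 : y * Gamma (y + 1 / 2) ^ 2 ≤ Gamma (y + 1) ^ 2 := by
      calc _ ≤ y * (Gamma y * Gamma (y + 1)) := by gcongr
        _ = _ := by rw [h3]; ring
    nlinarith
  have iter (n : ℕ) : f (x + n) ≤ f x := by
    induction n with
    | zero => simp
    | succ n ih =>
      refine le_trans ?_ ih
      have := step (y := x + n) (by positivity)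
      push_cast
      rwa [← add_assoc]
  have lim : Filter.Tendsto (fun n : ℕ ↦ (x + n) / (x + n + 1 / 4)) Filter.atTop (nhds 1) := by
    have h : Filter.Tendsto (fun n : ℕ ↦ 1 - (1 / 4) / (x + 1 / 4 + n))
        Filter.atTop (nhds (1 - 0)) :=
      tendsto_const_nhds.sub (tendsto_const_nhds.div_atTop
        (Filter.tendsto_atTop_add_const_left _ _ tendsto_natCast_atTop_atTop))
    rw [sub_zero] at h
    refine h.congr fun n ↦ ?_
    have : x + n + 1 / 4 ≠ 0 := by positivity
    have : x + 1 / 4 + n ≠ 0 := by positivity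
    field_simp
    ring
  have hf : 1 ≤ f x :=
    le_of_tendsto' lim fun n ↦ (lower (by positivity)).trans (iter n)
  have g2 := Gamma_pos_of_pos (show 0 < x + 1 / 2 by positivity)
  rwa [one_le_div (by positivity)] at hf

/-- The mean of `‖T‖₁ / √d` for `T` uniform on the unit sphere of `ℝ^d`. -/
noncomputable def meanNormRatio (d : ℕ) : ℝ :=
  2 * √d / (((d : ℝ) - 1) * realBeta (1 / 2) (((d : ℝ) - 1) / 2))

lemma realBeta_pos {a b : ℝ} (ha : 0 < a) (hb : 0 < b) : 0 < realBeta a b := by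
  have := Gamma_pos_of_pos ha
  have := Gamma_pos_of_pos hb
  have := Gamma_pos_of_pos (add_pos ha hb)
  unfold realBeta
  positivity

lemma meanNormRatio_eq (d : ℕ) (hd : 2 ≤ d) :
    meanNormRatio d = √d / √π * (Gamma (d / 2) / Gamma ((d + 1) / 2)) := by
  have hd1 : 0 < (d : ℝ) - 1 := by
    have : (2 : ℝ) ≤ d := by exact_mod_cast hd
    linarith
  have h1 : Gamma (((d : ℝ) + 1) / 2) = ((d : ℝ) - 1) / 2 * Gamma (((d : ℝ) - 1) / 2) := by
    rw [← Gamma_add_one (by positivity)]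
    ring_nf
  have h2 : (1 / 2 : ℝ) + ((d : ℝ) - 1) / 2 = d / 2 := by ring
  have hΓ : 0 < Gamma (((d : ℝ) - 1) / 2) := Gamma_pos_of_pos (by positivity)
  have hΓ' : 0 < Gamma ((d : ℝ) / 2) := Gamma_pos_of_pos (by linarith)
  have hπ : 0 < √π := sqrt_pos.2 pi_pos
  rw [meanNormRatio, realBeta, h1, h2, Gamma_one_half_eq]
  field_simp

lemma le_meanNormRatio_sq (d : ℕ) (hd : 2 ≤ d) :
    (2 * d + 1) / (π * d) ≤ meanNormRatio d ^ 2 := by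
  have hd0 : (0 : ℝ) < d := by positivity
  have h := add_quarter_mul_Gamma_sq_le (x := (d : ℝ) / 2) (by positivity)
  rw [Gamma_add_one (by positivity), show (d : ℝ) / 2 + 1 / 2 = (d + 1) / 2 by ring] at h
  have hΓ : 0 < Gamma (((d : ℝ) + 1) / 2) := Gamma_pos_of_pos (by positivity)
  rw [meanNormRatio_eq d hd, mul_pow, div_pow, div_pow, sq_sqrt hd0.le, sq_sqrt pi_pos.le,
    div_mul_div_comm, div_le_div_iff₀ (by positivity) (by positivity)]
  have := mul_le_mul_of_nonneg_left h (show 0 ≤ 4 * π by positivity)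
  nlinarith

lemma integral_normRatio_stdGaussian (d : ℕ) (hd : 2 ≤ d) :
    ∫ z, (∑ i, |z i|) / (√d * √(∑ i, z i ^ 2)) ∂stdGaussian d = meanNormRatio d := by
  have h := integral_stdGaussian_div_norm_pow d (by lia) (fun z ↦ ∑ i, |z i|) 1
    fun r hr z ↦ by simp [abs_mul, abs_of_pos hr, Finset.mul_sum]
  simp_rw [div_mul_eq_div_div_swap]
  rw [integral_div]
  simp only [pow_one] at h
  have hd0 : (0 : ℝ) < d := by positivity
  have hs : √(d : ℝ) ^ 2 = d := sq_sqrt hd0.le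
  have hs0 : 0 < √(d : ℝ) := sqrt_pos.2 hd0
  rw [h, integral_sum_abs_stdGaussian, meanNormRatio_eq d hd, Nat.cast_one, ← sqrt_eq_rpow,
    sqrt_div two_pos.le, sqrt_div one_pos.le, sqrt_one]
  have : 0 < √π := sqrt_pos.2 pi_pos
  have : 0 < Gamma (((d : ℝ) + 1) / 2) := Gamma_pos_of_pos (by positivity)
  field_simp
  rw [hs]

lemma integral_normRatio_sq_stdGaussian (d : ℕ) (hd : 2 ≤ d) :
    ∫ z, ((∑ i, |z i|) / (√d * √(∑ i, z i ^ 2))) ^ 2 ∂stdGaussian d =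
      1 / d + 2 * (d - 1) / (π * d) := by
  have h := integral_stdGaussian_div_norm_pow d (by lia) (fun z ↦ (∑ i, |z i|) ^ 2) 2
    fun r hr z ↦ by simp [abs_mul, abs_of_pos hr, ← Finset.mul_sum, mul_pow]
  have hd0 : (0 : ℝ) < d := by positivity
  simp_rw [div_mul_eq_div_div_swap, div_pow _ √(d : ℝ), div_pow _ √(∑ i, _)]
  have hΓ : 0 < Gamma ((d : ℝ) / 2) := Gamma_pos_of_pos (by positivity)
  rw [integral_div, h, integral_sum_abs_sq_stdGaussian, sq_sqrt hd0.le, Nat.cast_ofNat,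
    show ((d : ℝ) + 2) / 2 = d / 2 + 1 by ring, Gamma_add_one (by positivity), div_self two_ne_zero,
    rpow_one]
  field_simp

lemma normRatio_mem_Icc {d : ℕ} (z : Fin d → ℝ) :
    (∑ i, |z i|) / (√d * √(∑ i, z i ^ 2)) ∈ Set.Icc 0 1 := by
  refine ⟨by positivity, div_le_one_of_le₀ ?_ (by positivity)⟩
  rw [← sqrt_mul d.cast_nonneg]
  refine le_sqrt_of_sq_le ?_
  simpa using sq_sum_le_card_mul_sum_sq (s := Finset.univ) (f := fun i ↦ |z i|)

lemma memLp_normRatio_stdGaussian (d : ℕ) :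
    MemLp (fun z : Fin d → ℝ ↦ (∑ i, |z i|) / (√d * √(∑ i, z i ^ 2))) 2 (stdGaussian d) := by
  refine MemLp.of_bound (Measurable.aestronglyMeasurable (by fun_prop)) 1 (.of_forall fun z ↦ ?_)
  rw [norm_of_nonneg (normRatio_mem_Icc z).1]
  exact (normRatio_mem_Icc z).2

lemma integral_normRatio_sub_mean_sq_le (d : ℕ) (hd : 2 ≤ d) :
    ∫ z, ((∑ i, |z i|) / (√d * √(∑ i, z i ^ 2)) - meanNormRatio d) ^ 2 ∂stdGaussian d ≤
      (π - 3) / (π * d) := by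
  have hint := (memLp_normRatio_stdGaussian d).integrable one_le_two
  have hint2 := (memLp_normRatio_stdGaussian d).integrable_sq
  have hd0 : (0 : ℝ) < d := by positivity
  simp_rw [sub_sq]
  rw [integral_add (by exact hint2.sub ((hint.const_mul 2).mul_const _)) (integrable_const _),
    integral_sub hint2 ((hint.const_mul 2).mul_const _), integral_mul_const, integral_const_mul,
    integral_normRatio_stdGaussian d hd, integral_normRatio_sq_stdGaussian d hd, integral_const]
  have h := le_meanNormRatio_sq d hd
  have e : 1 / (d : ℝ) + 2 * (d - 1) / (π * d) - (2 * d + 1) / (π * d) = (π - 3) / (π * d) := by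
    field_simp
    ring
  simp only [probReal_univ, one_smul]
  linarith

lemma card_mul_sum_sq_div_sq_le {d : ℕ} (z : Fin d → ℝ) :
    (d : ℝ) * (∑ i, z i ^ 2) / (∑ i, |z i|) ^ 2 ≤ d := by
  refine div_le_of_le_mul₀ (by positivity) (by positivity) ?_
  gcongr
  simpa using Finset.sum_sq_le_sq_sum_of_nonneg (s := Finset.univ) (f := fun i ↦ |z i|)
    fun i _ ↦ abs_nonneg _

lemma inv_sq_normRatio {d : ℕ} (z : Fin d → ℝ) :
    (((∑ i, |z i|) / (√d * √(∑ i, z i ^ 2))) ^ 2)⁻¹ =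
      (d : ℝ) * (∑ i, z i ^ 2) / (∑ i, |z i|) ^ 2 := by
  rw [div_pow, inv_div, mul_pow, sq_sqrt d.cast_nonneg,
    sq_sqrt (Finset.sum_nonneg fun i _ ↦ sq_nonneg _)]

lemma inv_sqrt_add_sqrt_le_meanNormRatio (d : ℕ) (hd : 2 ≤ d) :
    1 / √d + √((π - 3) / (π * d)) ≤ meanNormRatio d := by
  have hd2 : (2 : ℝ) ≤ d := by exact_mod_cast hd
  have hd1 : 0 < (d : ℝ) - 1 := by linarith
  have hm : 0 ≤ meanNormRatio d := by
    have := realBeta_pos (a := 1 / 2) (b := ((d : ℝ) - 1) / 2) (by norm_num) (by positivity)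
    unfold meanNormRatio
    positivity
  refine le_trans ?_ (abs_le_of_sq_le_sq' ((sq_sqrt (by positivity)).trans_le
    (le_meanNormRatio_sq d hd)) hm).2
  have hπ : 0 < π - 3 := by linarith [pi_gt_three]
  have e1 : 1 / √(d : ℝ) = √π / √(π * d) := by
    rw [sqrt_mul pi_pos.le]
    have : 0 < √π := sqrt_pos.2 pi_pos
    field_simp
  rw [e1, sqrt_div hπ.le, sqrt_div (by positivity), ← add_div]
  gcongr
  have hπ1 : √π ≤ 1.78 := sqrt_le_iff.2 ⟨by norm_num, by linarith [pi_lt_d2]⟩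
  have hπ2 : √(π - 3) ≤ 0.4 := sqrt_le_iff.2 ⟨by norm_num, by linarith [pi_lt_d2]⟩
  refine le_sqrt_of_sq_le ?_
  nlinarith [sqrt_nonneg π, sqrt_nonneg (π - 3)]

theorem unbiased_drive_chebyshev_bound (d : ℕ) (hd : 2 ≤ d) (k : ℝ) (hk : 0 < k)
    (hk2 : k < ((d : ℝ) / ((d : ℝ) - 1)) * Real.sqrt (π / (π - 3)) *
      (2 / realBeta (1 / 2) (((d : ℝ) - 1) / 2))) :
    (∫ z, (d : ℝ) * (∑ i, (z i) ^ 2) / (∑ i, |z i|) ^ 2 ∂stdGaussian d)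
      ≤ (d : ℝ) / k ^ 2 + (1 - 1 / k ^ 2) /
        (-k * Real.sqrt ((π - 3) / (π * d)) +
          2 * Real.sqrt d / (((d : ℝ) - 1) * realBeta (1 / 2) (((d : ℝ) - 1) / 2))) ^ 2 := by
  have hd2 : (2 : ℝ) ≤ d := by exact_mod_cast hd
  have hd0 : (0 : ℝ) < d := by linarith
  have hd1 : 0 < (d : ℝ) - 1 := by linarith
  have hπ : 0 < π - 3 := by linarith [pi_gt_three]
  have hB := realBeta_pos (a := 1 / 2) (b := ((d : ℝ) - 1) / 2) (by norm_num) (by positivity)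
  have hsep := inv_sqrt_add_sqrt_le_meanNormRatio d hd
  have hvar := integral_normRatio_sub_mean_sq_le d hd
  change _ ≤ (d : ℝ) / k ^ 2 + (1 - 1 / k ^ 2) /
    (-k * √((π - 3) / (π * d)) + meanNormRatio d) ^ 2
  have hσ2 : √((π - 3) / (π * d)) ^ 2 = (π - 3) / (π * d) := sq_sqrt (by positivity)
  have hσ : 0 < √((π - 3) / (π * d)) := sqrt_pos.2 (by positivity)
  have hkσ : k * √((π - 3) / (π * d)) < meanNormRatio d := by
    calc k * √((π - 3) / (π * d)) < _ := mul_lt_mul_of_pos_right hk2 hσ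
      _ = meanNormRatio d := by
        rw [meanNormRatio, sqrt_div pi_pos.le, sqrt_div hπ.le, sqrt_mul pi_pos.le]
        have : 0 < √π := sqrt_pos.2 pi_pos
        have : 0 < √(π - 3) := sqrt_pos.2 hπ
        have : 0 < √(d : ℝ) := sqrt_pos.2 hd0
        field_simp
        rw [sq_sqrt hd0.le]
  set σ := √((π - 3) / (π * d))
  set m := meanNormRatio d
  set t := -k * σ + m with ht
  have ht0 : 0 < t := by linarith
  have hbound : ∫ z, (d : ℝ) * (∑ i, (z i) ^ 2) / (∑ i, |z i|) ^ 2 ∂stdGaussian d ≤ d := by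
    refine (integral_mono_of_nonneg (.of_forall fun z ↦ by positivity) (integrable_const (d : ℝ))
      (.of_forall card_mul_sum_sq_div_sq_le)).trans_eq ?_
    simp
  have hrhs : (d : ℝ) / k ^ 2 + (1 - 1 / k ^ 2) / t ^ 2 =
      1 / t ^ 2 + (d - 1 / t ^ 2) / k ^ 2 := by ring
  rcases le_or_gt (1 / √d) t with h | h
  · have hdt : 1 / t ^ 2 ≤ d := by
      rw [div_le_iff₀ (by positivity)] at h ⊢
      have := pow_le_pow_left₀ zero_le_one h 2
      rwa [mul_pow, sq_sqrt hd0.le, one_pow, mul_comm] at this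
    have hint : Integrable (fun z : Fin d → ℝ ↦
        ((∑ i, |z i|) / (√d * √(∑ i, z i ^ 2)) - m) ^ 2) (stdGaussian d) :=
      ((memLp_normRatio_stdGaussian d).sub (memLp_const m)).integrable_sq
    have hpt (z : Fin d → ℝ) : (d : ℝ) * (∑ i, (z i) ^ 2) / (∑ i, |z i|) ^ 2 ≤ 1 / t ^ 2 +
        (d - 1 / t ^ 2) / (k ^ 2 * σ ^ 2) *
          ((∑ i, |z i|) / (√d * √(∑ i, z i ^ 2)) - m) ^ 2 := by
      have hX := card_mul_sum_sq_div_sq_le z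
      have hXY := inv_sq_normRatio z
      set X := (d : ℝ) * (∑ i, (z i) ^ 2) / (∑ i, |z i|) ^ 2
      set Y := (∑ i, |z i|) / (√d * √(∑ i, z i ^ 2))
      have hc : 0 ≤ (d - 1 / t ^ 2) / (k ^ 2 * σ ^ 2) :=
        div_nonneg (by linarith) (by positivity)
      rcases le_or_gt Y t with hY | hY
      · have h1 : k ^ 2 * σ ^ 2 ≤ (Y - m) ^ 2 := by
          have : 0 < k * σ := by positivity
          nlinarith
        have h2 := mul_le_mul_of_nonneg_left h1 hc
        rw [div_mul_cancel₀ _ (by positivity)] at h2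
        linarith
      · have h1 : X ≤ 1 / t ^ 2 := by
          rw [← hXY, one_div]
          gcongr
        have := mul_nonneg hc (sq_nonneg (Y - m))
        linarith
    refine (integral_mono_of_nonneg (.of_forall fun z ↦ by positivity)
      ((integrable_const _).add (hint.const_mul _)) (.of_forall hpt)).trans ?_
    rw [integral_add' (integrable_const _) (hint.const_mul _), integral_const_mul, integral_const,
      hrhs, probReal_univ, one_smul]
    gcongr
    calc _ ≤ (d - 1 / t ^ 2) / (k ^ 2 * σ ^ 2) * σ ^ 2 := by
          rw [hσ2]
          exact mul_le_mul_of_nonneg_left hvar (div_nonneg (by linarith) (by positivity))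
      _ = _ := by field_simp
  · have hk1 : 1 ≤ k := by
      by_contra! hk1
      nlinarith
    have hdt : (d : ℝ) ≤ 1 / t ^ 2 := by
      rw [lt_div_iff₀ (by positivity)] at h
      rw [le_div_iff₀ (by positivity)]
      have := pow_le_pow_left₀ (by positivity) h.le 2
      rwa [mul_pow, sq_sqrt hd0.le, one_pow, mul_comm] at this
    refine hbound.trans ?_
    have h1 : 1 / k ^ 2 ≤ 1 := div_le_one_of_le₀ (by nlinarith) (by positivity)
    calc (d : ℝ) = d / k ^ 2 + (1 - 1 / k ^ 2) * d := by ring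
      _ ≤ d / k ^ 2 + (1 - 1 / k ^ 2) * (1 / t ^ 2) := by
        gcongr
      _ = _ := by ring
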